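/- Let u : ℝ × ℝ → ℝ be a C² solution of the Born–Infeld equation satisfying the regularity/decay and smallness hypotheses, and let λ(t) = C t/(log t)². Then there exists a constant K > 0 (depending only on C) such that for every t ≥ 2, | d/dt ∫_ℝ sech⁴(x/λ(t)) ( (1 + (∂ₓu)²)/(1 + (∂ₓu)² - (∂ₜu)²)^{1/2} - 1 )(t,x) dx | ≤ (K/λ(t)) ∫_ℝ sech²(x/λ(t)) ( (∂ₓu)² + (∂ₜu)² )(t,x) dx. -/

import Mathlib

open MeasureTheory Real Filter

/-- Time derivative `∂ₜ u` of a scalar field `u : ℝ × ℝ → ℝ` (first variable is time). -/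
noncomputable def ut (u : ℝ × ℝ → ℝ) (t x : ℝ) : ℝ := deriv (fun s => u (s, x)) t

/-- Space derivative `∂ₓ u`. -/
noncomputable def ux (u : ℝ × ℝ → ℝ) (t x : ℝ) : ℝ := deriv (fun y => u (t, y)) x

/-- `∂ₜ² u`. -/
noncomputable def utt (u : ℝ × ℝ → ℝ) (t x : ℝ) : ℝ := deriv (fun s => ut u s x) t

/-- `∂ₓ² u`. -/
noncomputable def uxx (u : ℝ × ℝ → ℝ) (t x : ℝ) : ℝ := deriv (fun y => ux u t y) x

/-- Mixed derivative `∂²ₜₓ u`. -/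
noncomputable def utx (u : ℝ × ℝ → ℝ) (t x : ℝ) : ℝ := deriv (fun s => ux u s x) t

/-- The Born–Infeld equation in 1+1 dimensions:
`(1 - (∂ₜu)²) ∂ₓ²u + 2 ∂ₓu ∂ₜu ∂²ₜₓu - (1 + (∂ₓu)²) ∂ₜ²u = 0`. -/
def IsBISol (u : ℝ × ℝ → ℝ) : Prop :=
  ∀ t x : ℝ,
    (1 - (ut u t x) ^ 2) * uxx u t x
      + 2 * ux u t x * ut u t x * utx u t x
      - (1 + (ux u t x) ^ 2) * utt u t x = 0

/-- The scaling function `λ(t) = C t / (log t)²`. -/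
noncomputable def lam (C t : ℝ) : ℝ := C * t / (Real.log t) ^ 2

/-- Hyperbolic secant. -/
noncomputable def sech (x : ℝ) : ℝ := 1 / Real.cosh x

/-- Differentiation under the integral sign over a compact interval, when the derivative is
jointly continuous on `S ×ˢ univ` with `S` open. -/
theorem hasDerivAt_intervalIntegral_of_continuousOn {f f' : ℝ → ℝ → ℝ} {S : Set ℝ} {t : ℝ}
    (a b : ℝ) (hS : IsOpen S) (ht : t ∈ S) (hf : ∀ s ∈ S, Continuous (f s))
    (hf' : ContinuousOn (fun z : ℝ × ℝ => f' z.1 z.2) (S ×ˢ Set.univ))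
    (hd : ∀ s ∈ S, ∀ x, HasDerivAt (fun r => f r x) (f' s x) s) :
    HasDerivAt (fun s => ∫ x in a..b, f s x) (∫ x in a..b, f' t x) t := by
  obtain ⟨δ, hδ, hball⟩ := Metric.nhds_basis_closedBall.mem_iff.1 (hS.mem_nhds ht)
  obtain ⟨M, hM⟩ := ((isCompact_closedBall t δ).prod (isCompact_uIcc (a := a) (b := b)))
    |>.exists_bound_of_continuousOn (hf'.mono (Set.prod_mono hball (Set.subset_univ _)))
  have hcont : Continuous (f' t) := by
    rw [← continuousOn_univ]
    exact hf'.comp (f := fun x => (t, x)) (by fun_prop) fun x _ => ⟨ht, trivial⟩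
  refine (intervalIntegral.hasDerivAt_integral_of_dominated_loc_of_deriv_le
    (bound := fun _ => M) (Metric.closedBall_mem_nhds t hδ) ?_ ?_ ?_ ?_ ?_ ?_).2
  · filter_upwards [hS.mem_nhds ht] with s hs
    exact (hf s hs).aestronglyMeasurable
  · exact (hf t ht).intervalIntegrable _ _
  · exact hcont.aestronglyMeasurable
  · exact Eventually.of_forall fun x hx s hs => hM (s, x) ⟨hs, Set.uIoc_subset_uIcc hx⟩
  · exact intervalIntegrable_const
  · exact Eventually.of_forall fun x _ s hs => hd s (hball hs) x

/-! ### Partial derivatives of a `C²` function of two variables -/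

theorem hasDerivAt_prodMk_left {F : Type*} [NormedAddCommGroup F] [NormedSpace ℝ F]
    {g : ℝ × ℝ → F} (hg : Differentiable ℝ g) (t x : ℝ) :
    HasDerivAt (fun s => g (s, x)) (fderiv ℝ g (t, x) (1, 0)) t :=
  (hg (t, x)).hasFDerivAt.comp_hasDerivAt t ((hasDerivAt_id t).prodMk (hasDerivAt_const t x))

theorem hasDerivAt_prodMk_right {F : Type*} [NormedAddCommGroup F] [NormedSpace ℝ F]
    {g : ℝ × ℝ → F} (hg : Differentiable ℝ g) (t x : ℝ) :
    HasDerivAt (fun y => g (t, y)) (fderiv ℝ g (t, x) (0, 1)) x :=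
  (hg (t, x)).hasFDerivAt.comp_hasDerivAt x ((hasDerivAt_const x t).prodMk (hasDerivAt_id x))

theorem ut_eq_fderiv {u : ℝ × ℝ → ℝ} (hu : Differentiable ℝ u) (t x : ℝ) :
    ut u t x = fderiv ℝ u (t, x) (1, 0) :=
  (hasDerivAt_prodMk_left hu t x).deriv

theorem ux_eq_fderiv {u : ℝ × ℝ → ℝ} (hu : Differentiable ℝ u) (t x : ℝ) :
    ux u t x = fderiv ℝ u (t, x) (0, 1) :=
  (hasDerivAt_prodMk_right hu t x).deriv

theorem contDiff_ut {u : ℝ × ℝ → ℝ} (hu : ContDiff ℝ 2 u) :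
    ContDiff ℝ 1 (fun z : ℝ × ℝ => ut u z.1 z.2) := by
  simp only [ut_eq_fderiv (hu.differentiable two_ne_zero)]
  exact (hu.fderiv_right (m := 1) (by norm_num)).clm_apply contDiff_const

theorem contDiff_ux {u : ℝ × ℝ → ℝ} (hu : ContDiff ℝ 2 u) :
    ContDiff ℝ 1 (fun z : ℝ × ℝ => ux u z.1 z.2) := by
  simp only [ux_eq_fderiv (hu.differentiable two_ne_zero)]
  exact (hu.fderiv_right (m := 1) (by norm_num)).clm_apply contDiff_const

theorem hasDerivAt_ut_left {u : ℝ × ℝ → ℝ} (hu : ContDiff ℝ 2 u) (t x : ℝ) :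
    HasDerivAt (fun s => ut u s x) (utt u t x) t :=
  (hasDerivAt_prodMk_left ((contDiff_ut hu).differentiable one_ne_zero)
    t x).differentiableAt.hasDerivAt

theorem hasDerivAt_ux_left {u : ℝ × ℝ → ℝ} (hu : ContDiff ℝ 2 u) (t x : ℝ) :
    HasDerivAt (fun s => ux u s x) (utx u t x) t :=
  (hasDerivAt_prodMk_left ((contDiff_ux hu).differentiable one_ne_zero)
    t x).differentiableAt.hasDerivAt

theorem hasDerivAt_ux_right {u : ℝ × ℝ → ℝ} (hu : ContDiff ℝ 2 u) (t x : ℝ) :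
    HasDerivAt (fun y => ux u t y) (uxx u t x) x :=
  (hasDerivAt_prodMk_right ((contDiff_ux hu).differentiable one_ne_zero)
    t x).differentiableAt.hasDerivAt

/-- Equality of mixed partial derivatives. -/
theorem hasDerivAt_ut_right {u : ℝ × ℝ → ℝ} (hu : ContDiff ℝ 2 u) (t x : ℝ) :
    HasDerivAt (fun y => ut u t y) (utx u t x) x := by
  have hu1 := hu.differentiable two_ne_zero
  have hD : Differentiable ℝ (fderiv ℝ u) :=
    (hu.fderiv_right (m := 1) (by norm_num)).differentiable one_ne_zero
  have hx := (hasDerivAt_prodMk_right hD t x).clm_apply (hasDerivAt_const x ((1 : ℝ), (0 : ℝ)))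
  have ht := (hasDerivAt_prodMk_left hD t x).clm_apply (hasDerivAt_const t ((0 : ℝ), (1 : ℝ)))
  simp only [← ut_eq_fderiv hu1, ← ux_eq_fderiv hu1, map_zero, add_zero] at hx ht
  have hsymm := (hu.contDiffAt (x := (t, x))).isSymmSndFDerivAt (by simp) (1, 0) (0, 1)
  rw [(hasDerivAt_ux_left hu t x).unique ht, hsymm]
  exact hx

theorem continuous_utx {u : ℝ × ℝ → ℝ} (hu : ContDiff ℝ 2 u) :
    Continuous (fun z : ℝ × ℝ => utx u z.1 z.2) := by
  have h := contDiff_ux hu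
  have heq (z : ℝ × ℝ) :
      utx u z.1 z.2 = fderiv ℝ (fun z : ℝ × ℝ => ux u z.1 z.2) z (1, 0) :=
    (hasDerivAt_prodMk_left (h.differentiable one_ne_zero) z.1 z.2).deriv
  simp only [heq]
  exact (h.continuous_fderiv one_ne_zero).clm_apply continuous_const

theorem continuous_uxx {u : ℝ × ℝ → ℝ} (hu : ContDiff ℝ 2 u) :
    Continuous (fun z : ℝ × ℝ => uxx u z.1 z.2) := by
  have h := contDiff_ux hu
  have heq (z : ℝ × ℝ) :
      uxx u z.1 z.2 = fderiv ℝ (fun z : ℝ × ℝ => ux u z.1 z.2) z (0, 1) :=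
    (hasDerivAt_prodMk_right (h.differentiable one_ne_zero) z.1 z.2).deriv
  simp only [heq]
  exact (h.continuous_fderiv one_ne_zero).clm_apply continuous_const

/-! ### Energy density and energy flux -/

/-- The Born–Infeld energy density, as a function of `p = ∂ₓu` and `q = ∂ₜu`. -/
noncomputable def biEnergy (p q : ℝ) : ℝ := (1 + p ^ 2) / √(1 + p ^ 2 - q ^ 2) - 1

/-- The Born–Infeld energy flux, as a function of `p = ∂ₓu` and `q = ∂ₜu`. -/
noncomputable def biFlux (p q : ℝ) : ℝ := p * q / √(1 + p ^ 2 - q ^ 2)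

/-- The derivative of `biFlux` along a curve in the `(p, q)`-plane with given velocity. -/
noncomputable def biFluxDeriv (p q p' q' : ℝ) : ℝ :=
  (p' * q + p * q') / √(1 + p ^ 2 - q ^ 2)
    - p * q * (p * p' - q * q') / √(1 + p ^ 2 - q ^ 2) ^ 3

theorem one_fourth_le_of_abs_le {q : ℝ} (p : ℝ) (hq : |q| ≤ 1 / 2) :
    1 / 4 ≤ 1 + p ^ 2 - q ^ 2 := by
  nlinarith [abs_le.1 hq, sq_nonneg p]

theorem one_half_le_sqrt_of_abs_le {q : ℝ} (p : ℝ) (hq : |q| ≤ 1 / 2) :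
    1 / 2 ≤ √(1 + p ^ 2 - q ^ 2) :=
  Real.le_sqrt_of_sq_le ((by norm_num : (1 / 2 : ℝ) ^ 2 = 1 / 4) ▸ one_fourth_le_of_abs_le p hq)

theorem abs_biEnergy_le {q : ℝ} (p : ℝ) (hq : |q| ≤ 1 / 2) :
    |biEnergy p q| ≤ 4 * (p ^ 2 + q ^ 2) := by
  have hw := one_half_le_sqrt_of_abs_le p hq
  have hsq := Real.sq_sqrt (by linarith [one_fourth_le_of_abs_le p hq] :
    0 ≤ 1 + p ^ 2 - q ^ 2)
  rw [biEnergy]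
  set w := √(1 + p ^ 2 - q ^ 2)
  have hw0 : 0 < w := by linarith
  rw [div_sub_one hw0.ne', abs_div, abs_of_pos hw0, div_le_iff₀ hw0, abs_le]
  have hp := sq_nonneg p
  have hq2 := sq_nonneg q
  have h1 : |w - 1| ≤ p ^ 2 + q ^ 2 := by
    rw [abs_le]; constructor <;> rcases le_total w 1 with h | h <;> nlinarith
  have h2 := abs_le.1 h1
  constructor <;> nlinarith [mul_nonneg (add_nonneg hp hq2) (sub_nonneg.2 hw)]

theorem abs_biFlux_le {q : ℝ} (p : ℝ) (hq : |q| ≤ 1 / 2) :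
    |biFlux p q| ≤ p ^ 2 + q ^ 2 := by
  have hw := one_half_le_sqrt_of_abs_le p hq
  rw [biFlux]
  set w := √(1 + p ^ 2 - q ^ 2)
  have hw0 : 0 < w := by linarith
  rw [abs_div, abs_of_pos hw0, div_le_iff₀ hw0, abs_le]
  have h := mul_nonneg (add_nonneg (sq_nonneg p) (sq_nonneg q)) (sub_nonneg.2 hw)
  constructor <;> nlinarith [sq_nonneg (p + q), sq_nonneg (p - q)]

theorem HasDerivAt.biFlux {p q : ℝ → ℝ} {p' q' x : ℝ} (hp : HasDerivAt p p' x)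
    (hq : HasDerivAt q q' x) (hq2 : |q x| ≤ 1 / 2) :
    HasDerivAt (fun y => _root_.biFlux (p y) (q y)) (biFluxDeriv (p x) (q x) p' q') x := by
  have hpos : 0 < 1 + p x ^ 2 - q x ^ 2 := by linarith [one_fourth_le_of_abs_le (p x) hq2]
  have hsqrt := (((hp.pow 2).const_add 1).sub (hq.pow 2)).sqrt hpos.ne'
  have hw := (Real.sqrt_pos.2 hpos).ne'
  convert! (hp.mul hq).div hsqrt hw using 1
  simp only [biFluxDeriv, Pi.pow_apply, Pi.sub_apply, Pi.mul_apply]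
  field_simp
  push_cast
  ring

/-- Local conservation of energy: the Born–Infeld equation says `∂ₜ e = ∂ₓ (energy flux)`. -/
theorem HasDerivAt.biEnergy {p q : ℝ → ℝ} {px m q' t : ℝ} (hp : HasDerivAt p m t)
    (hq : HasDerivAt q q' t) (hq2 : |q t| ≤ 1 / 2)
    (heq : (1 - q t ^ 2) * px + 2 * p t * q t * m - (1 + p t ^ 2) * q' = 0) :
    HasDerivAt (fun s => _root_.biEnergy (p s) (q s)) (biFluxDeriv (p t) (q t) px m) t := by
  have hpos : 0 < 1 + p t ^ 2 - q t ^ 2 := by linarith [one_fourth_le_of_abs_le (p t) hq2]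
  have hsqrt := (((hp.pow 2).const_add 1).sub (hq.pow 2)).sqrt hpos.ne'
  have hw := (Real.sqrt_pos.2 hpos).ne'
  convert! (((hp.pow 2).const_add 1).div hsqrt hw).sub_const 1 using 1
  simp only [biFluxDeriv, Pi.pow_apply, Pi.sub_apply]
  have hsq := Real.sq_sqrt hpos.le
  field_simp
  push_cast
  rw [hsq]
  linear_combination 2 * q t * heq

/-! ### The cutoff -/

/-- The derivative of `sech ^ 4`. -/
noncomputable def sechPowFourDeriv (y : ℝ) : ℝ := -4 * Real.sinh y / Real.cosh y ^ 5

theorem hasDerivAt_sech_pow_four (y : ℝ) :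
    HasDerivAt (fun y => sech y ^ 4) (sechPowFourDeriv y) y := by
  have hc := (Real.cosh_pos y).ne'
  convert! ((hasDerivAt_const y (1 : ℝ)).div (Real.hasDerivAt_cosh y) hc).pow 4 using 1
  norm_num [sechPowFourDeriv]
  field_simp

theorem continuous_sech : Continuous sech :=
  continuous_const.div Real.continuous_cosh fun y => (Real.cosh_pos y).ne'

theorem continuous_sechPowFourDeriv : Continuous sechPowFourDeriv :=
  (Real.continuous_sinh.const_mul (-4)).div (Real.continuous_cosh.pow 5)
    fun y => (pow_pos (Real.cosh_pos y) 5).ne'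

theorem abs_sinh_le_cosh (y : ℝ) : |Real.sinh y| ≤ Real.cosh y :=
  abs_le_of_sq_le_sq (by linarith [Real.cosh_sq y]) (Real.cosh_pos y).le

theorem abs_le_cosh (y : ℝ) : |y| ≤ Real.cosh y :=
  calc |y| ≤ Real.sinh |y| := Real.self_le_sinh_iff.2 (abs_nonneg y)
    _ = |Real.sinh y| := (Real.abs_sinh y).symm
    _ ≤ Real.cosh y := abs_sinh_le_cosh y

theorem abs_sechPowFourDeriv_mul_cosh_sq_le (y : ℝ) :
    |sechPowFourDeriv y| * Real.cosh y ^ 2 ≤ 4 * sech y ^ 2 := by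
  have hc := Real.cosh_pos y
  rw [sechPowFourDeriv, sech, abs_div, abs_mul, abs_of_pos (pow_pos hc 5)]
  norm_num
  field_simp
  exact abs_sinh_le_cosh y

theorem abs_sechPowFourDeriv_le (y : ℝ) : |sechPowFourDeriv y| ≤ 4 * sech y ^ 2 :=
  (le_mul_of_one_le_right (abs_nonneg _) (one_le_pow₀ (Real.one_le_cosh y))).trans
    (abs_sechPowFourDeriv_mul_cosh_sq_le y)

theorem abs_sechPowFourDeriv_mul_abs_le (y : ℝ) : |sechPowFourDeriv y| * |y| ≤ 4 * sech y ^ 2 := by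
  refine le_trans ?_ (abs_sechPowFourDeriv_mul_cosh_sq_le y)
  gcongr
  exact (abs_le_cosh y).trans (le_self_pow₀ (Real.one_le_cosh y) two_ne_zero)

/-! ### The scaling function -/

/-- The derivative of `lam C`. -/
noncomputable def lamDeriv (C t : ℝ) : ℝ := C * (1 / Real.log t ^ 2 - 2 / Real.log t ^ 3)

theorem lam_pos {C t : ℝ} (hC : 0 < C) (ht : 1 < t) : 0 < lam C t := by
  have := Real.log_pos ht
  unfold lam
  positivity

theorem hasDerivAt_lam (C : ℝ) {t : ℝ} (ht : 1 < t) : HasDerivAt (lam C) (lamDeriv C t) t := by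
  have hl := (Real.log_pos ht).ne'
  have ht0 : t ≠ 0 := by positivity
  convert! ((hasDerivAt_id t).const_mul C).div ((Real.hasDerivAt_log ht0).pow 2)
    (pow_ne_zero 2 hl) using 1
  simp only [lamDeriv, Pi.pow_apply, id_eq]
  field_simp
  push_cast
  ring

theorem continuousOn_lamDeriv (C : ℝ) : ContinuousOn (lamDeriv C) (Set.Ioi 1) := by
  have hl (t : ℝ) (ht : t ∈ Set.Ioi (1 : ℝ)) : Real.log t ≠ 0 := (Real.log_pos ht).ne'
  have hlog : ContinuousOn Real.log (Set.Ioi 1) :=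
    Real.continuousOn_log.mono fun t ht => (zero_lt_one.trans ht).ne'
  exact continuousOn_const.mul
    ((continuousOn_const.div (hlog.pow 2) fun t ht => pow_ne_zero 2 (hl t ht)).sub
      (continuousOn_const.div (hlog.pow 3) fun t ht => pow_ne_zero 3 (hl t ht)))

theorem abs_lamDeriv_le {C t : ℝ} (hC : 0 < C) (ht : 2 ≤ t) :
    |lamDeriv C t| ≤ C * (1 / Real.log 2 ^ 2 + 2 / Real.log 2 ^ 3) := by
  have h2 : 0 < Real.log 2 := Real.log_pos one_lt_two
  have hl : Real.log 2 ≤ Real.log t := Real.log_le_log two_pos ht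
  have hl0 := h2.trans_le hl
  rw [lamDeriv, abs_mul, abs_of_pos hC]
  gcongr
  refine (abs_sub _ _).trans ?_
  rw [abs_of_pos (by positivity), abs_of_pos (by positivity)]
  gcongr

/-- Energy estimate (Lemma 3.1): there is `K > 0` depending only on `C` such that for `t ≥ 2`,
`|d/dt ∫ sech⁴(x/λ(t)) ((1+(∂ₓu)²)/√(1+(∂ₓu)²-(∂ₜu)²) - 1) dx|`
`≤ (K/λ(t)) ∫ sech²(x/λ(t)) ((∂ₓu)² + (∂ₜu)²) dx`. -/
theorem energy_derivative_bound :
    ∃ ε₀ : ℝ, 0 < ε₀ ∧ ∀ C : ℝ, 0 < C → ∃ K : ℝ, 0 < K ∧ ∀ ε : ℝ, 0 < ε → ε ≤ ε₀ →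
    ∀ u : ℝ × ℝ → ℝ, ContDiff ℝ 2 u → IsBISol u →
    (∀ t x : ℝ, |ux u t x| + |ut u t x| ≤ ε) →
    (∀ t : ℝ, ∫ x : ℝ, ((ux u t x) ^ 2 + (ut u t x) ^ 2) ≤ ε ^ 2) →
    (∀ T : ℝ, ∃ R : ℝ, ∀ t x : ℝ, |t| ≤ T → R ≤ |x| → ux u t x = 0 ∧ ut u t x = 0) →
    ∀ t : ℝ, 2 ≤ t → ∃ d : ℝ,
      HasDerivAt
        (fun s : ℝ => ∫ x : ℝ, (sech (x / lam C s)) ^ 4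
          * ((1 + (ux u s x) ^ 2) / Real.sqrt (1 + (ux u s x) ^ 2 - (ut u s x) ^ 2) - 1)) d t ∧
      |d| ≤ (K / lam C t) * ∫ x : ℝ, (sech (x / lam C t)) ^ 2
          * ((ux u t x) ^ 2 + (ut u t x) ^ 2) := by
  refine ⟨1 / 2, by norm_num, fun C hC => ?_⟩
  set L := C * (1 / Real.log 2 ^ 2 + 2 / Real.log 2 ^ 3)
  have hL0 : 0 < L := by
    have : 0 < Real.log 2 := Real.log_pos one_lt_two
    positivity
  refine ⟨16 * L + 4, by positivity, fun ε _ hε u hu hBI hsmall _ hsupp t ht => ?_⟩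
  have hq (s x : ℝ) : |ut u s x| ≤ 1 / 2 := by
    linarith [hsmall s x, abs_nonneg (ux u s x)]
  obtain ⟨R₀, hR₀⟩ := hsupp (t + 1)
  set R := max R₀ 1
  have hR1 : 1 ≤ R := le_max_right _ _
  have hzero (s x : ℝ) (hs : |s| ≤ t + 1) (hx : R ≤ |x|) : ux u s x = 0 ∧ ut u s x = 0 :=
    hR₀ s x hs ((le_max_left _ _).trans hx)
  have hinterval (s : ℝ) (hs : |s| ≤ t + 1) (g : ℝ → ℝ)
      (hg : ∀ x, ux u s x = 0 → ut u s x = 0 → g x = 0) :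
      ∫ x, g x = ∫ x in (-R)..R, g x := by
    refine (intervalIntegral.integral_eq_integral_of_support_subset fun x hx => ?_).symm
    by_contra hcon
    have : R ≤ |x| := by
      by_contra! h
      exact hcon ⟨(abs_lt.1 h).1, (abs_lt.1 h).2.le⟩
    exact hx (hg x (hzero s x hs this).1 (hzero s x hs this).2)
  have htabs : |t| ≤ t + 1 := by rw [abs_of_nonneg] <;> linarith
  have ht1 : 1 < t := by linarith
  have hlam := lam_pos hC ht1
  have hcp := (contDiff_ux hu).continuous
  have hcq := (contDiff_ut hu).continuous
  have hpos (z : ℝ × ℝ) : √(1 + ux u z.1 z.2 ^ 2 - ut u z.1 z.2 ^ 2) ≠ 0 :=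
    (one_half_pos.trans_le (one_half_le_sqrt_of_abs_le _ (hq z.1 z.2))).ne'
  have hcw : Continuous fun z : ℝ × ℝ => √(1 + ux u z.1 z.2 ^ 2 - ut u z.1 z.2 ^ 2) := by
    fun_prop
  have hce : Continuous fun z : ℝ × ℝ => biEnergy (ux u z.1 z.2) (ut u z.1 z.2) :=
    ((continuous_const.add (hcp.pow 2)).div hcw hpos).sub continuous_const
  have hcf : Continuous fun z : ℝ × ℝ => biFlux (ux u z.1 z.2) (ut u z.1 z.2) :=
    (hcp.mul hcq).div hcw hpos
  have hcd : Continuous fun z : ℝ × ℝ =>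
      biFluxDeriv (ux u z.1 z.2) (ut u z.1 z.2) (uxx u z.1 z.2) (utx u z.1 z.2) := by
    have := continuous_uxx hu
    have := continuous_utx hu
    exact (Continuous.div (by fun_prop) hcw hpos).sub
      (Continuous.div (by fun_prop) (hcw.pow 3) fun z => pow_ne_zero 3 (hpos z))
  have hslice (x : ℝ) : Continuous fun y : ℝ => (x, y) := by fun_prop
  have hcS : Continuous fun y => sech y ^ 4 := continuous_sech.pow 4
  have hclam : ContinuousOn (fun z : ℝ × ℝ => lam C z.1) (Set.Ioi 1 ×ˢ Set.univ) :=
    ContinuousOn.comp (t := Set.Ioi 1)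
      (fun s hs => (hasDerivAt_lam C hs).continuousAt.continuousWithinAt)
      continuous_fst.continuousOn fun z hz => hz.1
  have hclam' : ContinuousOn (fun z : ℝ × ℝ => lamDeriv C z.1) (Set.Ioi 1 ×ˢ Set.univ) :=
    (continuousOn_lamDeriv C).comp continuous_fst.continuousOn fun z hz => hz.1
  have hlam0 (z : ℝ × ℝ) (hz : z ∈ Set.Ioi (1 : ℝ) ×ˢ (Set.univ : Set ℝ)) : lam C z.1 ≠ 0 :=
    (lam_pos hC hz.1).ne'
  have hcquot : ContinuousOn (fun z : ℝ × ℝ => z.2 / lam C z.1) (Set.Ioi 1 ×ˢ Set.univ) :=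
    continuous_snd.continuousOn.div hclam hlam0
  have hderiv := hasDerivAt_intervalIntegral_of_continuousOn (S := Set.Ioi 1) (t := t)
    (f := fun s x => sech (x / lam C s) ^ 4 * biEnergy (ux u s x) (ut u s x))
    (f' := fun s x => sechPowFourDeriv (x / lam C s) * (-(x * lamDeriv C s) / lam C s ^ 2)
        * biEnergy (ux u s x) (ut u s x)
      + sech (x / lam C s) ^ 4
        * biFluxDeriv (ux u s x) (ut u s x) (uxx u s x) (utx u s x))
    (-R) R isOpen_Ioi ht1
    (fun s _ => (hcS.comp (continuous_id.div_const _)).mul (hce.comp (hslice s)))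
    (by
      refine (ContinuousOn.mul (.mul ?_ ?_) hce.continuousOn).add
        (ContinuousOn.mul ?_ hcd.continuousOn)
      · exact continuous_sechPowFourDeriv.comp_continuousOn hcquot
      · exact ((continuous_snd.continuousOn.mul hclam').neg).div (hclam.pow 2)
          fun z hz => pow_ne_zero 2 (hlam0 z hz)
      · exact hcS.comp_continuousOn hcquot)
    (fun s hs x => by
      have hq' : HasDerivAt (fun r => x / lam C r) (-(x * lamDeriv C s) / lam C s ^ 2) s := by
        simpa using (hasDerivAt_const s x).fun_div (hasDerivAt_lam C hs) (lam_pos hC hs).ne'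
      exact ((hasDerivAt_sech_pow_four _).comp s hq').mul
        ((hasDerivAt_ux_left hu s x).biEnergy (hasDerivAt_ut_left hu s x) (hq s x) (hBI s x)))
  have hcont1 : Continuous fun x => sechPowFourDeriv (x / lam C t) :=
    continuous_sechPowFourDeriv.comp (continuous_id.div_const _)
  have hboundary :
      ∫ x in (-R)..R, (sechPowFourDeriv (x / lam C t) * (1 / lam C t)
          * biFlux (ux u t x) (ut u t x)
        + sech (x / lam C t) ^ 4
          * biFluxDeriv (ux u t x) (ut u t x) (uxx u t x) (utx u t x)) = 0 := by
    rw [intervalIntegral.integral_eq_sub_of_hasDerivAt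
      (f := fun x => sech (x / lam C t) ^ 4 * biFlux (ux u t x) (ut u t x))]
    · have h1 := hzero t R htabs (le_abs_self R)
      have h2 := hzero t (-R) htabs (by rw [abs_neg]; exact le_abs_self R)
      simp [h1, h2, biFlux]
    · intro x _
      exact ((hasDerivAt_sech_pow_four _).comp x ((hasDerivAt_id x).div_const _)).mul
        ((hasDerivAt_ux_right hu t x).biFlux (hasDerivAt_ut_right hu t x) (hq t x))
    · exact (((hcont1.mul continuous_const).mul (hcf.comp (hslice t))).add
        ((hcS.comp (continuous_id.div_const _)).mul
          (hcd.comp (hslice t)))).intervalIntegrable _ _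
  have hrate : |lamDeriv C t| ≤ L := abs_lamDeriv_le hC ht
  refine ⟨_, hderiv.congr_of_eventuallyEq ?_, ?_⟩
  · filter_upwards [Ioo_mem_nhds (by linarith : (0 : ℝ) < t) (lt_add_one t)] with s hs
    refine hinterval s (by rw [abs_of_pos hs.1]; exact hs.2.le) _ fun x hp hq => ?_
    simp [hp, hq]
  rw [hinterval t htabs _ fun x hp hq => by simp [hp, hq], ← sub_zero (intervalIntegral _ _ _ _),
    ← hboundary, ← intervalIntegral.integral_sub, ← intervalIntegral.integral_const_mul,
    ← Real.norm_eq_abs]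
  · refine intervalIntegral.norm_integral_le_of_norm_le (by linarith)
      (Eventually.of_forall fun x _ => ?_) (Continuous.intervalIntegrable ?_ _ _)
    · set y := x / lam C t with hy
      set E := biEnergy (ux u t x) (ut u t x)
      set F := biFlux (ux u t x) (ut u t x)
      set N := ux u t x ^ 2 + ut u t x ^ 2
      have hN0 : 0 ≤ N := by positivity
      have hE1 : |E| ≤ 4 * N := abs_biEnergy_le _ (hq t x)
      have hF1 : |F| ≤ N := abs_biFlux_le _ (hq t x)
      calc _ = |-(sechPowFourDeriv y * y * lamDeriv C t * E + sechPowFourDeriv y * F)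
              / lam C t| := by
            rw [Real.norm_eq_abs]
            congr 1
            generalize biFluxDeriv _ _ _ _ = D
            rw [show -(x * lamDeriv C t) / lam C t ^ 2 = -(y * lamDeriv C t) / lam C t by
              rw [hy]; field_simp]
            ring
        _ ≤ (4 * sech y ^ 2 * L * (4 * N) + 4 * sech y ^ 2 * N) / lam C t := by
            rw [abs_div, abs_neg, abs_of_pos hlam]
            gcongr
            refine (abs_add_le _ _).trans (add_le_add ?_ ?_)
            · rw [abs_mul, abs_mul, abs_mul]
              exact mul_le_mul (mul_le_mul (abs_sechPowFourDeriv_mul_abs_le y) hrate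
                (abs_nonneg _) (by positivity)) hE1 (abs_nonneg _) (by positivity)
            · rw [abs_mul]
              exact mul_le_mul (abs_sechPowFourDeriv_le y) hF1 (abs_nonneg _) (by positivity)
        _ = _ := by ring
    · exact continuous_const.mul (((continuous_sech.comp (continuous_id.div_const _)).pow 2).mul
        (((hcp.comp (hslice t)).pow 2).add ((hcq.comp (hslice t)).pow 2)))
  · exact (((hcont1.mul ((continuous_id.mul continuous_const).neg.div_const _)).mul
      (hce.comp (hslice t))).add ((hcS.comp (continuous_id.div_const _)).mul
        (hcd.comp (hslice t)))).intervalIntegrable _ _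
  · exact (((hcont1.mul continuous_const).mul (hcf.comp (hslice t))).add
      ((hcS.comp (continuous_id.div_const _)).mul
        (hcd.comp (hslice t)))).intervalIntegrable _ _
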